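/- Assume the Klein–Gordon setup and let Δ be the Hill discriminant associated with P(z) = V''(f(z))/(c²−1) and period T. Suppose Δ'(0) ≠ 0, Δ'(0) ≠ c²T², and Δ'(0)·(c²−1)·(c²T² − Δ'(0)) > 0 (i.e., the product of the modulational instability index γ_M := sgn(Δ'(0)) and the parity index γ_P := sgn((c²−1)(c²T² − Δ'(0))) equals +1). If moreover c² > 1 and there exists ν* < 0 with Δ(ν*)² > 4 (a gap of the Hill spectrum at negative ν), then there exists a nonzero β ∈ ℝ such that f exhibits a dynamical Hamiltonian–Hopf instability at iβ. -/

import Mathlib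

open Real Filter Set

noncomputable section

/-- The (Floquet) spectrum of the linearized Klein--Gordon spectral problem
`(c^2-1) w'' - 2 c lam w' + (lam^2 + Q z) w = 0`: the set of `lam : ℂ` for which
there is a nontrivial bounded solution `w : ℝ → ℂ`. -/
def KGSpectrum (c : ℝ) (Q : ℝ → ℝ) : Set ℂ :=
  {lam : ℂ | ∃ w wd wdd : ℝ → ℂ,
    (∀ z, HasDerivAt w (wd z) z) ∧ (∀ z, HasDerivAt wd (wdd z) z) ∧
    (∀ z : ℝ, ((c : ℂ) ^ 2 - 1) * wdd z - 2 * (c : ℂ) * lam * wd z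
        + (lam ^ 2 + (Q z : ℂ)) * w z = 0) ∧
    (∃ z, w z ≠ 0) ∧ (∃ M : ℝ, ∀ z, ‖w z‖ ≤ M)}

/-- The wave exhibits a dynamical Hamiltonian–Hopf instability at `lam` if every
neighborhood of `lam` contains a point of the spectrum that is not purely imaginary. -/
def HasDHHInstabilityAt (c : ℝ) (Q : ℝ → ℝ) (lam : ℂ) : Prop :=
  ∀ U ∈ nhds lam, ∃ μ ∈ KGSpectrum c Q, μ ∈ U ∧ μ.re ≠ 0

/-- `y1, y2` (with derivatives `y1d, y2d`) are the canonical fundamental solutions of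
Hill's equation `y'' + P y = ν y` with `y1(0)=1, y1'(0)=0, y2(0)=0, y2'(0)=1`,
for every value of the spectral parameter `ν`. -/
def IsHillFundamental (P : ℝ → ℝ) (y1 y1d y2 y2d : ℝ → ℝ → ℝ) : Prop :=
  ∀ ν : ℝ,
    (∀ z, HasDerivAt (y1 ν) (y1d ν z) z) ∧
    (∀ z, HasDerivAt (y1d ν) (ν * y1 ν z - P z * y1 ν z) z) ∧
    (∀ z, HasDerivAt (y2 ν) (y2d ν z) z) ∧
    (∀ z, HasDerivAt (y2d ν) (ν * y2 ν z - P z * y2 ν z) z) ∧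
    y1 ν 0 = 1 ∧ y1d ν 0 = 0 ∧ y2 ν 0 = 0 ∧ y2d ν 0 = 1



def Hsol (P : ℝ → ℝ) (ν : ℂ) (u v : ℝ → ℂ) : Prop :=
  (∀ z, HasDerivAt u (v z) z) ∧ ∀ z, HasDerivAt v ((ν - P z) * u z) z

lemma Hsol.wronskian {P : ℝ → ℝ} {ν : ℂ} {u v p q : ℝ → ℂ} (h : Hsol P ν u v)
    (k : Hsol P ν p q) (z : ℝ) : u z * q z - p z * v z = u 0 * q 0 - p 0 * v 0 := by
  have hd : ∀ z, HasDerivAt (fun z => u z * q z - p z * v z) 0 z := by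
    intro z
    refine (((h.1 z).fun_mul (k.2 z)).fun_sub ((k.1 z).fun_mul (h.2 z))).congr_deriv ?_
    ring
  exact is_const_of_deriv_eq_zero (fun z => (hd z).differentiableAt) (fun z => (hd z).deriv) z 0

lemma Hsol.rep {P : ℝ → ℝ} {ν : ℂ} {u v a a' b b' : ℝ → ℂ} (h : Hsol P ν u v)
    (ha : Hsol P ν a a') (hb : Hsol P ν b b') (h1 : a 0 = 1) (h2 : a' 0 = 0)
    (h3 : b 0 = 0) (h4 : b' 0 = 1) (z : ℝ) :
    u z = u 0 * a z + v 0 * b z ∧ v z = u 0 * a' z + v 0 * b' z := by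
  have w1 := h.wronskian ha z
  have w2 := h.wronskian hb z
  have w3 := ha.wronskian hb z
  rw [h1, h2] at w1
  rw [h3, h4] at w2
  rw [h1, h2, h3, h4] at w3
  constructor
  · linear_combination (-u z) * w3 + a z * w2 - b z * w1
  · linear_combination (-v z) * w3 + a' z * w2 - b' z * w1

lemma Hsol.shift {P : ℝ → ℝ} {ν : ℂ} {u v : ℝ → ℂ} (h : Hsol P ν u v) {T : ℝ}
    (hP : ∀ z, P (z + T) = P z) : Hsol P ν (fun z => u (z + T)) (fun z => v (z + T)) := by
  constructor
  · intro z; exact (h.1 (z + T)).comp_add_const z T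
  · intro z
    have := (h.2 (z + T)).comp_add_const z T
    rwa [hP] at this

lemma Hsol.comb {P : ℝ → ℝ} {ν : ℂ} {u v p q : ℝ → ℂ} (h : Hsol P ν u v)
    (k : Hsol P ν p q) (α β : ℂ) :
    Hsol P ν (fun z => α * u z + β * p z) (fun z => α * v z + β * q z) := by
  constructor
  · intro z; exact ((h.1 z).const_mul α).add ((k.1 z).const_mul β)
  · intro z
    refine (((h.2 z).const_mul α).fun_add ((k.2 z).const_mul β)).congr_deriv ?_
    ring

lemma floquet {P : ℝ → ℝ} {ν : ℂ} {a a' b b' : ℝ → ℂ} {T : ℝ} (hP : ∀ z, P (z + T) = P z)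
    (ha : Hsol P ν a a') (hb : Hsol P ν b b') (h1 : a 0 = 1) (h2 : a' 0 = 0)
    (h3 : b 0 = 0) (h4 : b' 0 = 1) {ρ : ℂ} (hρ : ρ ≠ 0) (hD : a T + b' T = ρ + ρ⁻¹) :
    ∃ u v : ℝ → ℂ, Hsol P ν u v ∧ (∃ z, u z ≠ 0) ∧ ∀ z, u (z + T) = ρ * u z := by
  have w := ha.wronskian hb T
  rw [h1, h2, h3, h4] at w
  have hchar : (a T - ρ) * (b' T - ρ) - b T * a' T = 0 := by
    have : ρ * (a T + b' T) = ρ ^ 2 + 1 := by rw [hD]; field_simp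
    linear_combination w - this
  obtain ⟨p, q, hpq, e1, e2⟩ : ∃ p q : ℂ, (p ≠ 0 ∨ q ≠ 0) ∧ p * a T + q * b T = ρ * p ∧
      p * a' T + q * b' T = ρ * q := by
    by_cases hb0 : b T = 0 ∧ a T = ρ
    · obtain ⟨hb0, ha0⟩ := hb0
      by_cases hx : a' T = 0 ∧ b' T = ρ
      · exact ⟨1, 0, by simp, by simp [ha0], by simp [hx.1]⟩
      · refine ⟨ρ - b' T, a' T, ?_, ?_, ?_⟩
        · by_contra! hcon
          exact hx ⟨hcon.2, (sub_eq_zero.1 hcon.1).symm⟩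
        · rw [hb0, ha0]; ring
        · ring
    · refine ⟨b T, ρ - a T, ?_, ?_, ?_⟩
      · by_contra! hcon
        exact hb0 ⟨hcon.1, (sub_eq_zero.1 hcon.2).symm⟩
      · ring
      · linear_combination -hchar
  have hu := ha.comb hb p q
  refine ⟨_, _, hu, ?_, ?_⟩
  · by_contra! hcon
    have c0 := hcon 0
    simp only [h1, h3] at c0
    have hp : p = 0 := by simpa using c0
    have hq : q = 0 := by
      have hd := hu.1 0
      have : (fun z => p * a z + q * b z) = fun _ => 0 := funext hcon
      rw [this] at hd
      have := hd.unique (hasDerivAt_const (0:ℝ) (0:ℂ))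
      simpa [h2, h4] using this
    rcases hpq with h | h
    · exact h hp
    · exact h hq
  · intro z
    have r := ((hu.shift hP).rep ha hb h1 h2 h3 h4 z).1
    simp only [zero_add] at r
    rw [r, e1, e2]; ring

lemma bounded_of_quasi {w : ℝ → ℂ} (hw : Continuous w) {T : ℝ} (hT : 0 < T)
    (h : ∀ z, ‖w (z + T)‖ = ‖w z‖) : ∃ M : ℝ, ∀ z, ‖w z‖ ≤ M := by
  have hp : Function.Periodic (fun z => ‖w z‖) T := h
  obtain ⟨M, hM⟩ := (isCompact_Icc (a := (0:ℝ)) (b := T)).bddAbove_image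
    (f := fun z => ‖w z‖) hw.norm.continuousOn
  refine ⟨M, fun z => ?_⟩
  obtain ⟨y, hy, hyz⟩ := hp.exists_mem_Ico₀ hT z
  have : ‖w z‖ = ‖w y‖ := hyz
  rw [this]
  exact hM ⟨y, ⟨hy.1, hy.2.le⟩, rfl⟩

lemma Hsol.spec {P Q : ℝ → ℝ} {c : ℝ} (hc : c ^ 2 ≠ 1) (hP : P = fun z => Q z / (c ^ 2 - 1))
    {s : ℂ} {u v : ℝ → ℂ} (h : Hsol P (-s ^ 2) u v) (hu : ∃ z, u z ≠ 0) {T : ℝ} (hT : 0 < T)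
    {ρ : ℂ} (hper : ∀ z, u (z + T) = ρ * u z) (hρ : ‖ρ‖ = Real.exp (c * T * s.im)) :
    ∃ w wd wdd : ℝ → ℂ,
    (∀ z, HasDerivAt w (wd z) z) ∧ (∀ z, HasDerivAt wd (wdd z) z) ∧
    (∀ z : ℝ, ((c : ℂ) ^ 2 - 1) * wdd z - 2 * (c : ℂ) * (Complex.I * (c ^ 2 - 1) * s) * wd z
        + ((Complex.I * (c ^ 2 - 1) * s) ^ 2 + (Q z : ℂ)) * w z = 0) ∧
    (∃ z, w z ≠ 0) ∧ (∃ M : ℝ, ∀ z, ‖w z‖ ≤ M) := by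
  have hc' : ((c : ℂ) ^ 2 - 1) ≠ 0 := by
    have : c ^ 2 - 1 ≠ 0 := sub_ne_zero.2 hc
    exact_mod_cast this
  set a : ℂ := Complex.I * c * s with ha
  have hE : ∀ z : ℝ, HasDerivAt (fun z : ℝ => Complex.exp (a * z)) (a * Complex.exp (a * z)) z := by
    intro z
    have h0 : HasDerivAt (fun z : ℝ => a * (z : ℂ)) a z := by
      simpa using (Complex.ofRealCLM.hasDerivAt (x := z)).const_mul a
    convert h0.cexp using 1
    ring
  have hw1 : ∀ z : ℝ, HasDerivAt (fun z : ℝ => Complex.exp (a * z) * u z)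
      (Complex.exp (a * z) * (a * u z + v z)) z := by
    intro z
    refine ((hE z).fun_mul (h.1 z)).congr_deriv ?_
    ring
  refine ⟨fun z => Complex.exp (a * z) * u z, fun z => Complex.exp (a * z) * (a * u z + v z),
    fun z => Complex.exp (a * z) * (a * (a * u z + v z) + (a * v z + (-s ^ 2 - P z) * u z)),
    hw1, ?_, ?_, ?_, ?_⟩
  · intro z
    refine ((hE z).fun_mul (((h.1 z).const_mul a).fun_add (h.2 z))).congr_deriv ?_
    ring
  · intro z
    have hPz : ((c : ℂ) ^ 2 - 1) * (P z : ℂ) = Q z := by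
      rw [hP]; push_cast; field_simp
    rw [← hPz, ha]
    linear_combination (Complex.exp (Complex.I * c * s * z) * s ^ 2 * u z * (c ^ 2 - 1)) * (-1) * (Complex.I_sq)
  · obtain ⟨z, hz⟩ := hu
    exact ⟨z, mul_ne_zero (Complex.exp_ne_zero _) hz⟩
  · refine bounded_of_quasi (continuous_iff_continuousAt.2 fun z => (hw1 z).continuousAt) hT ?_
    intro z
    simp only [norm_mul, hper, hρ, Complex.norm_exp]
    have : (a * ((z + T : ℝ) : ℂ)).re = (a * z).re - c * T * s.im := by
      simp [ha]; ring
    rw [this, Real.exp_sub]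
    have := Real.exp_pos (c * T * s.im)
    field_simp


set_option maxHeartbeats 2000000 in
lemma analytic_core (D : ℂ → ℂ) (hD : Differentiable ℂ D) (Δ : ℝ → ℝ)
    (hr : ∀ x : ℝ, D x = Δ x) (h0 : Δ 0 = 2) (k : ℝ) (hk : 0 < k)
    (hm : 0 < deriv Δ 0) (hm2 : deriv Δ 0 < k ^ 2) (hgap : ∃ νs : ℝ, νs < 0 ∧ Δ νs ^ 2 > 4) :
    ∃ s0 : ℝ, 0 < s0 ∧ ∀ U ∈ nhds (s0 : ℂ), ∃ s ∈ U, s.im ≠ 0 ∧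
      ∃ ρ : ℂ, ρ ≠ 0 ∧ ‖ρ‖ = Real.exp (k * s.im) ∧ D (-s ^ 2) = ρ + ρ⁻¹ := by
  obtain ⟨νs, hν, hνs⟩ := hgap
  have hΔre : Δ = fun x : ℝ => (D x).re := by ext x; simp [hr]
  have hΔd : ∀ x : ℝ, HasDerivAt Δ (deriv D x).re x := by
    intro x
    rw [hΔre]
    exact (hD x).hasDerivAt.real_of_complex
  set m := deriv Δ 0 with hmdef
  have hm' : (deriv D 0).re = m := by
    rw [hmdef, (hΔd 0).deriv]; simp
  have hdc : Continuous (deriv D) := hD.contDiff.continuous_deriv (n := 1) le_rfl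
  -- choose x small
  obtain ⟨x, hx0, hxν, hx⟩ : ∃ x : ℝ, 0 < x ∧ x < -νs ∧
      Δ (-x) ^ 2 + 4 * x * (deriv D (-x : ℝ)).re ^ 2 / k ^ 2 < 4 := by
    have hA : HasDerivAt (fun x : ℝ => Δ (-x) ^ 2) (-4 * m) 0 := by
      have h1 : HasDerivAt Δ m (-0) := by
        have := hΔd 0
        rw [neg_zero]; convert this using 1; simp [hm']
      have h2 := (h1.comp (0:ℝ) (hasDerivAt_neg 0)).pow 2
      refine h2.congr_deriv ?_
      simp only [Function.comp, neg_zero, h0]; norm_num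
    have hT1 : Tendsto (fun x : ℝ => (Δ (-x) ^ 2 - 4) / x) (nhdsWithin 0 (Ioi 0)) (nhds (-4 * m)) := by
      have := hA.tendsto_slope_zero_right
      simp only [zero_add, neg_zero, h0, smul_eq_mul] at this
      refine this.congr fun x => ?_
      ring
    have hT2 : Tendsto (fun x : ℝ => 4 * (deriv D (-x : ℝ)).re ^ 2 / k ^ 2) (nhdsWithin 0 (Ioi 0))
        (nhds (4 * m ^ 2 / k ^ 2)) := by
      have hc : Continuous (fun x : ℝ => 4 * (deriv D (-x : ℝ)).re ^ 2 / k ^ 2) := by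
        have : Continuous (fun x : ℝ => deriv D (-x : ℝ)) := hdc.comp (by fun_prop)
        fun_prop
      have := hc.tendsto 0
      simp only [neg_zero, Complex.ofReal_zero, hm'] at this
      exact this.mono_left nhdsWithin_le_nhds
    have hT := hT1.add hT2
    have hneg : -4 * m + 4 * m ^ 2 / k ^ 2 < 0 := by
      have : m ^ 2 / k ^ 2 < m := by
        rw [div_lt_iff₀ (by positivity)]; nlinarith
      have h' : 4 * m ^ 2 / k ^ 2 = 4 * (m ^ 2 / k ^ 2) := by ring
      rw [h']; linarith
    have e1 := hT.eventually (gt_mem_nhds hneg)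
    have e2 : ∀ᶠ x : ℝ in nhdsWithin 0 (Ioi 0), x < -νs :=
      nhdsWithin_le_nhds (gt_mem_nhds (by linarith))
    have e3 : ∀ᶠ x : ℝ in nhdsWithin 0 (Ioi 0), 0 < x := self_mem_nhdsWithin
    obtain ⟨x, h1, h2, h3⟩ := (e1.and (e2.and e3)).exists
    refine ⟨x, h3, h2, ?_⟩
    have : x * ((Δ (-x) ^ 2 - 4) / x + 4 * (deriv D (-x : ℝ)).re ^ 2 / k ^ 2) < 0 :=
      mul_neg_of_pos_of_neg h3 h1
    rw [mul_add, mul_div_cancel₀ _ h3.ne'] at this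
    have h' : 4 * x * (deriv D (-x : ℝ)).re ^ 2 / k ^ 2
      = x * (4 * (deriv D (-x : ℝ)).re ^ 2 / k ^ 2) := by ring
    rw [h']; linarith
  set δ := Real.sqrt x with hδ
  set t1 := Real.sqrt (-νs) with ht1
  have hδ0 : 0 < δ := Real.sqrt_pos.2 hx0
  have hδ2 : δ ^ 2 = x := Real.sq_sqrt hx0.le
  have ht2 : t1 ^ 2 = -νs := Real.sq_sqrt (by linarith)
  have hδt : δ ≤ t1 := Real.sqrt_le_sqrt hxν.le
  obtain ⟨G, hG⟩ : ∃ G : ℝ → ℝ → ℂ, ∀ ε t : ℝ, G ε t = D (-((t : ℂ) + ε * Complex.I) ^ 2) :=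
    ⟨_, fun _ _ => rfl⟩
  have hGc : Continuous (fun p : ℝ × ℝ => G p.1 p.2) := by
    simp only [hG]; exact hD.continuous.comp (by fun_prop)
  have hG0 : ∀ t : ℝ, G 0 t = Δ (-t ^ 2) := by
    intro t; simp only [hG]; rw [← hr]; simp
  let E : ℝ → ℝ → ℝ := fun ε t =>
    (G ε t).re ^ 2 / Real.cosh (k * ε) ^ 2 + (G ε t).im ^ 2 / Real.sinh (k * ε) ^ 2
  have hEc : ∀ ε, Continuous (E ε) := by
    intro ε
    have : Continuous (G ε) := hGc.comp (by fun_prop : Continuous fun t : ℝ => (ε, t))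
    simp only [E]; fun_prop
  have hreT : ∀ t : ℝ, Tendsto (fun ε => (G ε t).re ^ 2 / Real.cosh (k * ε) ^ 2)
      (nhdsWithin 0 (Ioi 0)) (nhds (Δ (-t ^ 2) ^ 2)) := by
    intro t
    have hc : Continuous (fun ε => (G ε t).re ^ 2 / Real.cosh (k * ε) ^ 2) := by
      have : Continuous (fun ε => G ε t) := hGc.comp (by fun_prop : Continuous fun ε : ℝ => (ε, t))
      refine Continuous.div (by fun_prop) (by fun_prop) ?_
      intro ε; have := Real.cosh_pos (k * ε); positivity
    have := hc.tendsto 0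
    simp only [hG0, mul_zero, Real.cosh_zero, Complex.ofReal_re, one_pow, div_one] at this
    exact this.mono_left nhdsWithin_le_nhds
  have hright : ∀ᶠ ε in nhdsWithin (0:ℝ) (Ioi 0), 4 < E ε t1 := by
    have hlt : 4 < Δ (-t1 ^ 2) ^ 2 := by rw [ht2, neg_neg]; exact hνs
    filter_upwards [(hreT t1).eventually (lt_mem_nhds hlt)] with ε hε
    have : 0 ≤ (G ε t1).im ^ 2 / Real.sinh (k * ε) ^ 2 := by positivity
    simp only [E]; linarith
  have hleft : ∀ᶠ ε in nhdsWithin (0:ℝ) (Ioi 0), E ε δ < 4 := by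
    have him : HasDerivAt (fun ε : ℝ => (G ε δ).im) (-2 * δ * (deriv D (-x : ℝ)).re) 0 := by
      have h1 : HasDerivAt (fun ε : ℝ => -((δ : ℂ) + ε * Complex.I) ^ 2)
          (-(2 * (δ : ℂ) * Complex.I)) 0 := by
        have hh : HasDerivAt (fun ε : ℝ => (δ : ℂ) + ε * Complex.I) Complex.I 0 := by
          simpa using (((Complex.ofRealCLM.hasDerivAt (x := (0:ℝ))).mul_const Complex.I).const_add (δ : ℂ))
        refine (hh.fun_pow 2).fun_neg.congr_deriv ?_
        simp
      have h2 : HasDerivAt D (deriv D (-x : ℝ)) (-((δ : ℂ) + ((0:ℝ) : ℂ) * Complex.I) ^ 2) := by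
        have : (-((δ : ℂ) + ((0:ℝ) : ℂ) * Complex.I) ^ 2) = ((-x : ℝ) : ℂ) := by
          rw [← hδ2]; simp
        rw [this]; exact (hD _).hasDerivAt
      have h3 := h2.comp (0:ℝ) h1
      simp only [hG]
      have h4 := (Complex.imCLM.hasFDerivAt.comp_hasDerivAt (0:ℝ) h3)
      refine HasDerivAt.congr_deriv h4 ?_
      simp; ring
    have hsinh : HasDerivAt (fun ε : ℝ => Real.sinh (k * ε)) k 0 := by
      have h1 : HasDerivAt (fun ε : ℝ => k * ε) k 0 := by
        simpa using (hasDerivAt_id (0:ℝ)).const_mul k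
      simpa using h1.sinh
    have s1 := him.tendsto_slope_zero_right
    have s2 := hsinh.tendsto_slope_zero_right
    simp only [zero_add, hG0, Complex.ofReal_im, sub_zero, smul_eq_mul, mul_zero, Real.sinh_zero] at s1 s2
    have s3 := (s1.div s2 hk.ne').pow 2
    have s4 := (hreT δ).add s3
    have hlt : Δ (-δ ^ 2) ^ 2 + (-2 * δ * (deriv D (-x : ℝ)).re / k) ^ 2 < 4 := by
      refine lt_of_eq_of_lt ?_ hx
      rw [hδ2, div_pow, mul_pow, mul_pow, hδ2]; ring
    have e3 : ∀ᶠ ε : ℝ in nhdsWithin 0 (Ioi 0), 0 < ε := self_mem_nhdsWithin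
    filter_upwards [s4.eventually (gt_mem_nhds hlt), e3] with ε hε hε0
    refine lt_of_eq_of_lt ?_ hε
    simp only [E, Pi.div_apply]
    congr 1
    have : Real.sinh (k * ε) ≠ 0 := (Real.sinh_pos_iff.2 (mul_pos hk hε0)).ne'
    field_simp
  have hcross : ∀ᶠ ε in nhdsWithin (0:ℝ) (Ioi 0), 0 < ε ∧ ∃ t ∈ Icc δ t1, E ε t = 4 := by
    have e3 : ∀ᶠ ε : ℝ in nhdsWithin 0 (Ioi 0), 0 < ε := self_mem_nhdsWithin
    filter_upwards [hleft, hright, e3] with ε h1 h2 h3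
    refine ⟨h3, ?_⟩
    obtain ⟨t, ht, hte⟩ := intermediate_value_Icc hδt (hEc ε).continuousOn ⟨h1.le, h2.le⟩
    exact ⟨t, ht, hte⟩
  have hseq : Tendsto (fun n : ℕ => 1 / ((n : ℝ) + 1)) atTop (nhdsWithin 0 (Ioi 0)) :=
    tendsto_nhdsWithin_iff.2 ⟨tendsto_one_div_add_atTop_nhds_zero_nat,
      Eventually.of_forall fun n => by simp only [mem_Ioi]; positivity⟩
  obtain ⟨N, hN⟩ := eventually_atTop.1 (hseq.eventually hcross)
  have hN' : ∀ n : ℕ, ∃ t ∈ Icc δ t1, E (1 / (((n + N : ℕ) : ℝ) + 1)) t = 4 :=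
    fun n => (hN (n + N) (by omega)).2
  choose τ hτ hτE using hN'
  obtain ⟨s0, hs0, φ, hφ, hlim⟩ := isCompact_Icc.tendsto_subseq hτ
  refine ⟨s0, lt_of_lt_of_le hδ0 hs0.1, fun U hU => ?_⟩
  have hε0 : Tendsto (fun n : ℕ => 1 / (((φ n + N : ℕ) : ℝ) + 1)) atTop (nhds 0) := by
    have := tendsto_one_div_add_atTop_nhds_zero_nat (𝕜 := ℝ)
    exact this.comp ((tendsto_add_atTop_nat N).comp hφ.tendsto_atTop)
  have hs : Tendsto (fun n : ℕ => ((τ (φ n) : ℝ) : ℂ) + ((1 / (((φ n + N : ℕ) : ℝ) + 1) : ℝ) : ℂ) * Complex.I)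
      atTop (nhds (s0 : ℂ)) := by
    have a1 := (Complex.continuous_ofReal.tendsto s0).comp hlim
    have a2 := ((Complex.continuous_ofReal.tendsto 0).comp hε0).mul_const Complex.I
    have := a1.add a2
    simp only [Complex.ofReal_zero, zero_mul, add_zero] at this
    exact this
  obtain ⟨n, hn⟩ := (hs.eventually hU).exists
  have hE4 := hτE (φ n)
  have hεp : 0 < 1 / (((φ n + N : ℕ) : ℝ) + 1) := by positivity
  generalize 1 / (((φ n + N : ℕ) : ℝ) + 1) = ε at hn hE4 hεp
  generalize τ (φ n) = t at hn hE4
  refine ⟨_, hn, ?_, ?_⟩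
  · simp [hεp.ne']
  · have hC := Real.cosh_pos (k * ε)
    have hS : 0 < Real.sinh (k * ε) := Real.sinh_pos_iff.2 (mul_pos hk hεp)
    let ζ : ℂ := ⟨(G ε t).re / (2 * Real.cosh (k * ε)), (G ε t).im / (2 * Real.sinh (k * ε))⟩
    have hζ : ‖ζ‖ = 1 := by
      have : ‖ζ‖ ^ 2 = 1 := by
        rw [Complex.sq_norm, Complex.normSq_mk]
        simp only [E] at hE4
        field_simp at hE4 ⊢
        linarith
      nlinarith [norm_nonneg ζ]
    have hre := Complex.norm_mul_cos_arg ζ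
    have him := Complex.norm_mul_sin_arg ζ
    rw [hζ, one_mul] at hre him
    set θ := Complex.arg ζ
    refine ⟨Complex.exp (((k * ε : ℝ) : ℂ) + θ * Complex.I), Complex.exp_ne_zero _, ?_, ?_⟩
    · rw [Complex.norm_exp]; simp
    · have key : D (-((t : ℂ) + ε * Complex.I) ^ 2)
          = 2 * Complex.cosh (((k * ε : ℝ) : ℂ) + θ * Complex.I) := by
        rw [← hG]
        have g1 : (G ε t).re = 2 * (Real.cosh (k * ε) * Real.cos θ) := by
          rw [hre]; simp only [ζ]; field_simp
        have g2 : (G ε t).im = 2 * (Real.sinh (k * ε) * Real.sin θ) := by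
          rw [him]; simp only [ζ]; field_simp
        rw [Complex.cosh_add, Complex.cosh_mul_I, Complex.sinh_mul_I, ← Complex.ofReal_cosh,
          ← Complex.ofReal_sinh, ← Complex.ofReal_cos, ← Complex.ofReal_sin]
        generalize Real.cosh (k * ε) = C at g1
        generalize Real.sinh (k * ε) = S at g2
        generalize Real.cos θ = x1 at g1
        generalize Real.sin θ = x2 at g2
        apply Complex.ext
        · rw [g1]; simp
        · rw [g2]; simp
      rw [key, ← Complex.exp_neg, Complex.cosh]; ring


/-- Coefficients of the expansion of a Hill solution in powers of the spectral parameter. -/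
def hillPair (a a' b b' φ0 ψ0 : ℝ → ℝ) : ℕ → (ℝ → ℝ) × (ℝ → ℝ)
  | 0 => (φ0, ψ0)
  | n + 1 =>
    (fun z => b z * (∫ t in (0:ℝ)..z, a t * (hillPair a a' b b' φ0 ψ0 n).1 t)
        - a z * (∫ t in (0:ℝ)..z, b t * (hillPair a a' b b' φ0 ψ0 n).1 t),
     fun z => b' z * (∫ t in (0:ℝ)..z, a t * (hillPair a a' b b' φ0 ψ0 n).1 t)
        - a' z * (∫ t in (0:ℝ)..z, b t * (hillPair a a' b b' φ0 ψ0 n).1 t))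

lemma int_bound {g : ℝ → ℝ} {C L z : ℝ} {n : ℕ}
    (h : ∀ t, |t| ≤ L → |g t| ≤ C * |t| ^ n) (hz : |z| ≤ L) :
    |∫ t in (0:ℝ)..z, g t| ≤ C * (|z| ^ (n + 1) / (n + 1)) := by
  have h1 := integral_pow_abs_sub_uIoc (a := (0:ℝ)) (b := z) (n := n)
  simp only [sub_zero] at h1
  rw [← h1, ← MeasureTheory.integral_const_mul, ← Real.norm_eq_abs,
    intervalIntegral.norm_integral_eq_norm_integral_uIoc]
  apply MeasureTheory.norm_integral_le_of_norm_le
  · have : IntervalIntegrable (fun t : ℝ => C * |t| ^ n) MeasureTheory.volume 0 z :=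
      Continuous.intervalIntegrable (by fun_prop) _ _
    exact this.def'
  · rw [MeasureTheory.ae_restrict_iff' measurableSet_uIoc]
    refine Eventually.of_forall fun t ht => h t ?_
    have h2 := uIoc_subset_uIcc ht
    rcases le_total 0 z with h0 | h0
    · rw [uIcc_of_le h0] at h2
      rw [abs_of_nonneg h2.1]; exact h2.2.trans ((le_abs_self z).trans hz)
    · rw [uIcc_of_ge h0] at h2
      rw [abs_of_nonpos h2.2]; linarith [h2.1, neg_abs_le z]

section
variable {P a a' b b' φ0 ψ0 : ℝ → ℝ}

lemma hillPair_spec (ha : ∀ z, HasDerivAt a (a' z) z) (ha' : ∀ z, HasDerivAt a' (-P z * a z) z)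
    (hb : ∀ z, HasDerivAt b (b' z) z) (hb' : ∀ z, HasDerivAt b' (-P z * b z) z)
    (hW : ∀ z, a z * b' z - b z * a' z = 1)
    (h0 : ∀ z, HasDerivAt φ0 (ψ0 z) z) (n : ℕ) :
    (∀ z, HasDerivAt (hillPair a a' b b' φ0 ψ0 n).1 ((hillPair a a' b b' φ0 ψ0 n).2 z) z) ∧
    (∀ z, HasDerivAt (hillPair a a' b b' φ0 ψ0 (n + 1)).2
      ((hillPair a a' b b' φ0 ψ0 n).1 z - P z * (hillPair a a' b b' φ0 ψ0 (n + 1)).1 z) z) := by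
  have hac : Continuous a := continuous_iff_continuousAt.2 fun z => (ha z).continuousAt
  have hbc : Continuous b := continuous_iff_continuousAt.2 fun z => (hb z).continuousAt
  have key : ∀ n, (∀ z, HasDerivAt (hillPair a a' b b' φ0 ψ0 n).1
      ((hillPair a a' b b' φ0 ψ0 n).2 z) z) →
      (∀ z, HasDerivAt (hillPair a a' b b' φ0 ψ0 (n + 1)).1
        ((hillPair a a' b b' φ0 ψ0 (n + 1)).2 z) z) ∧
      (∀ z, HasDerivAt (hillPair a a' b b' φ0 ψ0 (n + 1)).2
      ((hillPair a a' b b' φ0 ψ0 n).1 z - P z * (hillPair a a' b b' φ0 ψ0 (n + 1)).1 z) z) := by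
    intro n hn
    simp only [hillPair]
    have hc : Continuous (hillPair a a' b b' φ0 ψ0 n).1 :=
      continuous_iff_continuousAt.2 fun z => (hn z).continuousAt
    generalize (hillPair a a' b b' φ0 ψ0 n).1 = φ at hc
    have I1 : ∀ z, HasDerivAt (fun z => ∫ t in (0:ℝ)..z, a t * φ t) (a z * φ z) z :=
      fun z => (hac.mul hc).integral_hasStrictDerivAt 0 z |>.hasDerivAt
    have I2 : ∀ z, HasDerivAt (fun z => ∫ t in (0:ℝ)..z, b t * φ t) (b z * φ z) z :=
      fun z => (hbc.mul hc).integral_hasStrictDerivAt 0 z |>.hasDerivAt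
    constructor
    · intro z
      refine (((hb z).fun_mul (I1 z)).fun_sub ((ha z).fun_mul (I2 z))).congr_deriv ?_
      ring
    · intro z
      refine (((hb' z).fun_mul (I1 z)).fun_sub ((ha' z).fun_mul (I2 z))).congr_deriv ?_
      linear_combination (φ z) * hW z
  have all : ∀ n, ∀ z, HasDerivAt (hillPair a a' b b' φ0 ψ0 n).1
      ((hillPair a a' b b' φ0 ψ0 n).2 z) z := by
    intro n
    induction n with
    | zero => simpa [hillPair] using h0
    | succ n ih => exact (key n ih).1
  exact ⟨all n, (key n (all n)).2⟩

lemma hillPair_bound (hac : Continuous a) (hac' : Continuous a') (hbc : Continuous b)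
    (hbc' : Continuous b') (hc : Continuous φ0) (hc' : Continuous ψ0) (L R : ℝ) (hL : 0 ≤ L)
    (hR : 0 ≤ R) :
    ∃ u : ℕ → ℝ, Summable u ∧ ∀ n z, |z| ≤ L → R ^ n * |(hillPair a a' b b' φ0 ψ0 n).1 z| ≤ u n ∧
      R ^ n * |(hillPair a a' b b' φ0 ψ0 n).2 z| ≤ u n := by
  obtain ⟨B, hB⟩ := (isCompact_Icc (a := -L) (b := L)).bddAbove_image
    (f := fun z => |a z| + |a' z| + |b z| + |b' z| + |φ0 z| + |ψ0 z|) (by fun_prop)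
  have hB' : ∀ z, |z| ≤ L → |a z| + |a' z| + |b z| + |b' z| + |φ0 z| + |ψ0 z| ≤ B :=
    fun z hz => hB ⟨z, abs_le.1 hz, rfl⟩
  have hB0 : 0 ≤ B := le_trans (by positivity) (hB' 0 (by simpa using hL))
  have main : ∀ n z, |z| ≤ L → |(hillPair a a' b b' φ0 ψ0 n).1 z| ≤ B * (2 * B ^ 2) ^ n / n.factorial * |z| ^ n ∧
      |(hillPair a a' b b' φ0 ψ0 n).2 z| ≤ B * (2 * B ^ 2) ^ n / n.factorial * |z| ^ n := by
    intro n
    induction n with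
    | zero =>
      intro z hz
      have := hB' z hz
      have := abs_nonneg (a z)
      have := abs_nonneg (b z)
      have := abs_nonneg (a' z)
      have := abs_nonneg (b' z)
      have := abs_nonneg (φ0 z)
      have := abs_nonneg (ψ0 z)
      simp only [hillPair, pow_zero, Nat.factorial_zero, Nat.cast_one, mul_one, div_one]
      constructor <;> linarith
    | succ n ih =>
      intro z hz
      simp only [hillPair]
      have ih1 := fun z hz => (ih z hz).1
      generalize (hillPair a a' b b' φ0 ψ0 n).1 = φ at ih1
      set C := B * (2 * B ^ 2) ^ n / n.factorial with hC
      have hC0 : 0 ≤ C := by positivity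
      have bd : ∀ t, |t| ≤ L → |a t| ≤ B ∧ |b t| ≤ B ∧ |a' t| ≤ B ∧ |b' t| ≤ B := by
        intro t ht
        have := hB' t ht
        have := abs_nonneg (a t)
        have := abs_nonneg (b t)
        have := abs_nonneg (a' t)
        have := abs_nonneg (b' t)
        have := abs_nonneg (φ0 t)
        have := abs_nonneg (ψ0 t)
        refine ⟨?_, ?_, ?_, ?_⟩ <;> linarith
      have J1 : |∫ t in (0:ℝ)..z, a t * φ t| ≤ B * C * (|z| ^ (n + 1) / (n + 1)) := by
        refine int_bound (fun t ht => ?_) hz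
        rw [abs_mul, mul_assoc]
        exact mul_le_mul (bd t ht).1 (ih1 t ht) (abs_nonneg _) hB0
      have J2 : |∫ t in (0:ℝ)..z, b t * φ t| ≤ B * C * (|z| ^ (n + 1) / (n + 1)) := by
        refine int_bound (fun t ht => ?_) hz
        rw [abs_mul, mul_assoc]
        exact mul_le_mul (bd t ht).2.1 (ih1 t ht) (abs_nonneg _) hB0
      generalize (∫ t in (0:ℝ)..z, a t * φ t) = i1 at J1
      generalize (∫ t in (0:ℝ)..z, b t * φ t) = i2 at J2
      have hfin : B * (2 * B ^ 2) ^ (n + 1) / (n + 1).factorial * |z| ^ (n + 1)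
          = B * (B * C * (|z| ^ (n + 1) / (n + 1))) + B * (B * C * (|z| ^ (n + 1) / (n + 1))) := by
        rw [hC, Nat.factorial_succ]; push_cast; field_simp; ring
      rw [hfin]
      obtain ⟨b1, b2, b3, b4⟩ := bd z hz
      constructor
      · refine (abs_sub _ _).trans (add_le_add ?_ ?_)
        · rw [abs_mul]; exact mul_le_mul b2 J1 (abs_nonneg _) hB0
        · rw [abs_mul]; exact mul_le_mul b1 J2 (abs_nonneg _) hB0
      · refine (abs_sub _ _).trans (add_le_add ?_ ?_)
        · rw [abs_mul]; exact mul_le_mul b4 J1 (abs_nonneg _) hB0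
        · rw [abs_mul]; exact mul_le_mul b3 J2 (abs_nonneg _) hB0
  refine ⟨fun n => B * ((R * (2 * B ^ 2) * L) ^ n / n.factorial),
    (Real.summable_pow_div_factorial _).mul_left B, fun n z hz => ?_⟩
  have hfin : R ^ n * (B * (2 * B ^ 2) ^ n / n.factorial * |z| ^ n)
      ≤ B * ((R * (2 * B ^ 2) * L) ^ n / n.factorial) := by
    have h1 : B * ((R * (2 * B ^ 2) * L) ^ n / n.factorial)
      = R ^ n * (B * (2 * B ^ 2) ^ n / n.factorial * L ^ n) := by
      rw [mul_pow, mul_pow]; ring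
    rw [h1]
    gcongr
  exact ⟨(mul_le_mul_of_nonneg_left (main n z hz).1 (by positivity)).trans hfin,
    (mul_le_mul_of_nonneg_left (main n z hz).2 (by positivity)).trans hfin⟩
end

set_option maxHeartbeats 2000000 in
lemma hill_complex {P a a' b b' φ0 ψ0 : ℝ → ℝ} (hPc : Continuous P)
    (ha : ∀ z, HasDerivAt a (a' z) z) (ha' : ∀ z, HasDerivAt a' (-P z * a z) z)
    (hb : ∀ z, HasDerivAt b (b' z) z) (hb' : ∀ z, HasDerivAt b' (-P z * b z) z)
    (hW : ∀ z, a z * b' z - b z * a' z = 1)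
    (h0 : ∀ z, HasDerivAt φ0 (ψ0 z) z) (h0' : ∀ z, HasDerivAt ψ0 (-P z * φ0 z) z) :
    ∃ Y Y' : ℂ → ℝ → ℂ, (∀ ν, Hsol P ν (Y ν) (Y' ν)) ∧
      (∀ ν, Y ν 0 = φ0 0 ∧ Y' ν 0 = ψ0 0) ∧
      ∀ z, Differentiable ℂ (fun ν => Y ν z) ∧ Differentiable ℂ (fun ν => Y' ν z) := by
  have hspec := hillPair_spec ha ha' hb hb' hW h0
  have hcont : ∀ {f g : ℝ → ℝ}, (∀ z, HasDerivAt f (g z) z) → Continuous f :=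
    fun h => continuous_iff_continuousAt.2 fun z => (h z).continuousAt
  have hbound := hillPair_bound (hcont ha) (hcont ha') (hcont hb) (hcont hb') (hcont h0) (hcont h0')
  have hz1 : ∀ n, (hillPair a a' b b' φ0 ψ0 (n + 1)).1 0 = 0 := by intro n; simp [hillPair]
  have hz2 : ∀ n, (hillPair a a' b b' φ0 ψ0 (n + 1)).2 0 = 0 := by intro n; simp [hillPair]
  have hφ00 : (hillPair a a' b b' φ0 ψ0 0).1 = φ0 := rfl
  have hψ00 : (hillPair a a' b b' φ0 ψ0 0).2 = ψ0 := rfl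
  generalize hillPair a a' b b' φ0 ψ0 = F at hspec hbound hz1 hz2 hφ00 hψ00
  have hsum : ∀ (ν : ℂ) (z : ℝ), Summable (fun n => ν ^ n * ((F n).1 z : ℂ)) ∧
      Summable (fun n => ν ^ n * ((F n).2 z : ℂ)) := by
    intro ν z
    obtain ⟨u, hu, hb⟩ := hbound |z| ‖ν‖ (abs_nonneg z) (norm_nonneg ν)
    constructor
    · refine Summable.of_norm_bounded hu fun n => ?_
      simpa using (hb n z le_rfl).1
    · refine Summable.of_norm_bounded hu fun n => ?_
      simpa using (hb n z le_rfl).2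
  refine ⟨fun ν z => ∑' n, ν ^ n * ((F n).1 z : ℂ), fun ν z => ∑' n, ν ^ n * ((F n).2 z : ℂ),
    fun ν => ⟨fun z => ?_, fun z => ?_⟩, fun ν => ⟨?_, ?_⟩, fun z => ⟨?_, ?_⟩⟩
  · obtain ⟨u, hu, hbd⟩ := hbound (|z| + 1) ‖ν‖ (by positivity) (norm_nonneg ν)
    have hzt : z ∈ Ioo (-(|z| + 1)) (|z| + 1) := by
      constructor <;> linarith [neg_abs_le z, le_abs_self z]
    refine hasDerivAt_tsum_of_isPreconnected (t := Ioo (-(|z| + 1)) (|z| + 1))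
      (g := fun n z => ν ^ n * ((F n).1 z : ℂ)) (g' := fun n z => ν ^ n * ((F n).2 z : ℂ)) hu isOpen_Ioo
      isPreconnected_Ioo (fun n y _ => ?_) (fun n y hy => ?_) hzt (hsum ν z).1 hzt
    · exact ((hspec n).1 y).ofReal_comp.const_mul (ν ^ n)
    · simpa using (hbd n y (abs_le.2 ⟨hy.1.le, hy.2.le⟩)).2
  · obtain ⟨u, hu, hbd⟩ := hbound (|z| + 1) ‖ν‖ (by positivity) (norm_nonneg ν)
    have hzt : z ∈ Ioo (-(|z| + 1)) (|z| + 1) := by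
      constructor <;> linarith [neg_abs_le z, le_abs_self z]
    obtain ⟨p, hp⟩ := (isCompact_Icc (a := -(|z| + 1)) (b := |z| + 1)).bddAbove_image
      (f := fun z => |P z|) (by fun_prop)
    have hp' : ∀ y ∈ Ioo (-(|z| + 1)) (|z| + 1), |P y| ≤ p :=
      fun y hy => hp ⟨y, ⟨hy.1.le, hy.2.le⟩, rfl⟩
    let χ : ℕ → ℝ → ℝ := fun n => match n with
      | 0 => fun y => - P y * (F 0).1 y
      | n + 1 => fun y => (F n).1 y - P y * (F (n + 1)).1 y
    let u' : ℕ → ℝ := fun n => match n with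
      | 0 => p * u 0
      | n + 1 => ‖ν‖ * u n + p * u (n + 1)
    have hu' : Summable u' := by
      rw [← summable_nat_add_iff 1]
      exact (hu.mul_left _).add (((summable_nat_add_iff 1).2 hu).mul_left p)
    have hχ : ∀ n, ∀ y ∈ Ioo (-(|z| + 1)) (|z| + 1), ‖ν ^ n * (χ n y : ℂ)‖ ≤ u' n := by
      intro n y hy
      have hy' := abs_le.2 ⟨hy.1.le, hy.2.le⟩
      have hpy := hp' y hy
      have hp0 : 0 ≤ p := (abs_nonneg _).trans hpy
      rw [norm_mul, norm_pow, Complex.norm_real, Real.norm_eq_abs]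
      cases n with
      | zero =>
        simp only [χ, u', pow_zero, one_mul, abs_mul, abs_neg]
        have := (hbd 0 y hy').1
        rw [pow_zero, one_mul] at this
        exact mul_le_mul hpy this (abs_nonneg _) hp0
      | succ n =>
        simp only [χ, u']
        have i1 := (hbd n y hy').1
        have i2 := (hbd (n + 1) y hy').1
        calc ‖ν‖ ^ (n + 1) * |(F n).1 y - P y * (F (n + 1)).1 y|
            ≤ ‖ν‖ ^ (n + 1) * (|(F n).1 y| + |P y| * |(F (n + 1)).1 y|) := by
              gcongr
              rw [← abs_mul]; exact abs_sub _ _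
          _ = ‖ν‖ * (‖ν‖ ^ n * |(F n).1 y|) + |P y| * (‖ν‖ ^ (n + 1) * |(F (n + 1)).1 y|) := by ring
          _ ≤ _ := by gcongr
    have hd := hasDerivAt_tsum_of_isPreconnected (t := Ioo (-(|z| + 1)) (|z| + 1))
      (g := fun n z => ν ^ n * ((F n).2 z : ℂ)) (g' := fun n z => ν ^ n * (χ n z : ℂ)) hu' isOpen_Ioo
      isPreconnected_Ioo (fun n y _ => ?_) hχ hzt (hsum ν z).2 hzt
    · refine hd.congr_deriv ?_
      have hs1 := (hsum ν z).1
      have hs2 : Summable (fun n => ν ^ n * (χ n z : ℂ)) := by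
        exact Summable.of_norm_bounded hu' fun n => hχ n z hzt
      rw [hs2.tsum_eq_zero_add, sub_mul]
      have e1 : ∀ n, ν ^ (n + 1) * (χ (n + 1) z : ℂ) = ν * (ν ^ n * ((F n).1 z : ℂ))
          - P z * (ν ^ (n + 1) * ((F (n + 1)).1 z : ℂ)) := by
        intro n; simp only [χ]; push_cast; ring
      simp_rw [e1]
      rw [(hs1.mul_left ν).tsum_sub (((summable_nat_add_iff 1).2 hs1).mul_left _), tsum_mul_left,
        tsum_mul_left]
      have e2 := hs1.tsum_eq_zero_add
      have e3 : ν ^ 0 * (χ 0 z : ℂ) = - P z * (ν ^ 0 * ((F 0).1 z : ℂ)) := by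
        simp only [χ]; push_cast; ring
      rw [e3]
      linear_combination (P z : ℂ) * e2
    · cases n with
      | zero =>
        have := (h0' y).ofReal_comp.const_mul (ν ^ 0)
        simpa [χ, hφ00, hψ00] using this
      | succ n => exact ((hspec n).2 y).ofReal_comp.const_mul (ν ^ (n + 1))
  · show ∑' n, ν ^ n * ((F n).1 0 : ℂ) = _
    rw [tsum_eq_single 0]
    · simp [hφ00]
    · intro n hn
      obtain ⟨k, rfl⟩ := Nat.exists_eq_succ_of_ne_zero hn
      simp [hz1]
  · show ∑' n, ν ^ n * ((F n).2 0 : ℂ) = _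
    rw [tsum_eq_single 0]
    · simp [hψ00]
    · intro n hn
      obtain ⟨k, rfl⟩ := Nat.exists_eq_succ_of_ne_zero hn
      simp [hz2]
  · intro ν
    obtain ⟨u, hu, hbd⟩ := hbound |z| (‖ν‖ + 1) (abs_nonneg z) (by positivity)
    refine (Complex.differentiableOn_tsum_of_summable_norm (U := Metric.ball 0 (‖ν‖ + 1)) hu
      (fun n => by fun_prop) Metric.isOpen_ball (fun n w hw => ?_)).differentiableAt
      (Metric.isOpen_ball.mem_nhds (by simp))
    have hw' : ‖w‖ ≤ ‖ν‖ + 1 := by simpa using (mem_ball_zero_iff.1 hw).le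
    refine le_trans ?_ (hbd n z le_rfl).1
    rw [norm_mul, norm_pow, Complex.norm_real, Real.norm_eq_abs]
    gcongr
  · intro ν
    obtain ⟨u, hu, hbd⟩ := hbound |z| (‖ν‖ + 1) (abs_nonneg z) (by positivity)
    refine (Complex.differentiableOn_tsum_of_summable_norm (U := Metric.ball 0 (‖ν‖ + 1)) hu
      (fun n => by fun_prop) Metric.isOpen_ball (fun n w hw => ?_)).differentiableAt
      (Metric.isOpen_ball.mem_nhds (by simp))
    have hw' : ‖w‖ ≤ ‖ν‖ + 1 := by simpa using (mem_ball_zero_iff.1 hw).le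
    refine le_trans ?_ (hbd n z le_rfl).2
    rw [norm_mul, norm_pow, Complex.norm_real, Real.norm_eq_abs]
    gcongr


lemma Hsol.ofReal {P : ℝ → ℝ} {ν : ℝ} {u v : ℝ → ℝ} (h1 : ∀ z, HasDerivAt u (v z) z)
    (h2 : ∀ z, HasDerivAt v (ν * u z - P z * u z) z) :
    Hsol P (ν : ℂ) (fun z => (u z : ℂ)) (fun z => (v z : ℂ)) := by
  refine ⟨fun z => (h1 z).ofReal_comp, fun z => (h2 z).ofReal_comp.congr_deriv ?_⟩
  push_cast; ring

theorem dhh_exists_of_gap_superluminal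
    (V : ℝ → ℝ) (hV : ContDiff ℝ 2 V)
    (c : ℝ) (hc : c ^ 2 ≠ 1)
    (f fd fdd : ℝ → ℝ)
    (hf : ∀ z, HasDerivAt f (fd z) z)
    (hfd : ∀ z, HasDerivAt fd (fdd z) z)
    (hwave : ∀ z, (c ^ 2 - 1) * fdd z + deriv V (f z) = 0)
    (T : ℝ) (hT : 0 < T)
    (hper : ∀ z, fd (z + T) = fd z)
    (hnt : ∃ z, fd z ≠ 0)
    (Q : ℝ → ℝ) (hQ : Q = fun z => deriv (deriv V) (f z))
    (P : ℝ → ℝ) (hP : P = fun z => Q z / (c ^ 2 - 1))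
    (y1 y1d y2 y2d : ℝ → ℝ → ℝ)
    (hfund : IsHillFundamental P y1 y1d y2 y2d)
    (Δ : ℝ → ℝ) (hΔ : Δ = fun ν => y1 ν T + y2d ν T)
    (hd0 : deriv Δ 0 ≠ 0)
    (hgen : deriv Δ 0 ≠ c ^ 2 * T ^ 2)
    (hprod : deriv Δ 0 * (c ^ 2 - 1) * (c ^ 2 * T ^ 2 - deriv Δ 0) > 0)
    (hsuper : c ^ 2 > 1)
    (hgap : ∃ νs : ℝ, νs < 0 ∧ Δ νs ^ 2 > 4) :
    ∃ β : ℝ, β ≠ 0 ∧ HasDHHInstabilityAt c Q (Complex.I * β) := by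
  obtain ⟨a1, a2, a3, a4, i1, i2, i3, i4⟩ := hfund 0
  have hc1 : 0 < c ^ 2 - 1 := by linarith
  have hm : 0 < deriv Δ 0 := by
    by_contra hcon
    have hneg : deriv Δ 0 < 0 := lt_of_le_of_ne (not_lt.1 hcon) hd0
    have : 0 < c ^ 2 * T ^ 2 - deriv Δ 0 := by
      have : 0 ≤ c ^ 2 * T ^ 2 := by positivity
      linarith
    nlinarith [mul_pos (mul_pos (neg_pos.2 hneg) hc1) this]
  have hm2 : deriv Δ 0 < (|c| * T) ^ 2 := by
    rw [mul_pow, sq_abs]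
    have := (pos_iff_pos_of_mul_pos hprod).1 (mul_pos hm hc1)
    linarith
  have hc0 : c ≠ 0 := by rintro rfl; norm_num at hsuper
  have hfc : Continuous f := continuous_iff_continuousAt.2 fun z => (hf z).continuousAt
  have hfdc : Continuous fd := continuous_iff_continuousAt.2 fun z => (hfd z).continuousAt
  have hV1 : ContDiff ℝ 1 (deriv V) := by
    have : ContDiff ℝ (1 + 1) V := by simpa [one_add_one_eq_two] using hV
    exact (contDiff_succ_iff_deriv.1 this).2.2
  have hV2c : Continuous (deriv (deriv V)) := hV1.continuous_deriv le_rfl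
  have hPc : Continuous P := by
    rw [hP, hQ]; exact (hV2c.comp hfc).div_const _
  have hfdd : ∀ z, fdd z = -(deriv V (f z)) / (c ^ 2 - 1) := by
    intro z
    rw [eq_div_iff hc1.ne']; linarith [hwave z]
  have hfd3 : ∀ z, HasDerivAt fdd (0 * fd z - P z * fd z) z := by
    intro z
    have h1 : HasDerivAt (fun z => deriv V (f z)) (deriv (deriv V) (f z) * fd z) z :=
      ((hV1.differentiable one_ne_zero) (f z)).hasDerivAt.comp z (hf z)
    rw [funext hfdd]
    refine (h1.fun_neg.div_const _).congr_deriv ?_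
    rw [hP, hQ]; ring
  have H0 : Hsol P ((0 : ℝ) : ℂ) (fun z => (fd z : ℂ)) (fun z => (fdd z : ℂ)) := Hsol.ofReal hfd hfd3
  have HA := Hsol.ofReal a1 a2
  have HB := Hsol.ofReal a3 a4
  have rep0 := fun z => H0.rep HA HB (by simp [i1]) (by simp [i2]) (by simp [i3]) (by simp [i4]) z
  -- translation
  have hzero : ∀ z0, fd z0 = 0 → fdd z0 = 0 → False := by
    intro z0 e1 e2
    have w1 := fun z => H0.wronskian HA z
    have w2 := fun z => H0.wronskian HB z
    have e3 := w1 z0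
    have e4 := w2 z0
    simp only [e1, e2, i1, i2, i3, i4, Complex.ofReal_zero, Complex.ofReal_one, mul_zero, zero_mul, sub_zero,
      mul_one, one_mul, zero_sub] at e3 e4
    obtain ⟨z, hz⟩ := hnt
    apply hz
    have := (rep0 z).1
    rw [← e4, neg_eq_zero.1 e3.symm] at this
    simpa using this
  have hfddper : ∀ z, fdd (z + T) = fdd z := by
    intro z
    have h1 := (hfd (z + T)).comp_add_const z T
    have h2 : (fun x => fd (x + T)) = fd := funext hper
    rw [h2] at h1
    exact h1.unique (hfd z)
  have hPmul : ∀ z, (P (z + T) - P z) * fd z = 0 := by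
    intro z
    have h1 := (hfd3 (z + T)).comp_add_const z T
    have h2 : (fun x => fdd (x + T)) = fdd := funext hfddper
    rw [h2] at h1
    have := h1.unique (hfd3 z)
    rw [hper] at this
    linarith
  have hPper : ∀ z, P (z + T) = P z := by
    intro z
    have hcl : IsClosed {z | P (z + T) = P z} := isClosed_eq (by fun_prop) hPc
    by_cases hz : fd z = 0
    · have hne : fdd z ≠ 0 := fun h => hzero z hz h
      have hev := (hfd z).eventually_ne (c := 0) hne
      have hfr : ∃ᶠ y in nhdsWithin z {z}ᶜ, y ∈ {z | P (z + T) = P z} := by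
        refine Eventually.frequently ?_
        filter_upwards [hev] with y hy
        rcases mul_eq_zero.1 (hPmul y) with h | h
        · exact sub_eq_zero.1 h
        · exact absurd h hy
      have := mem_closure_iff_frequently.2 (hfr.filter_mono nhdsWithin_le_nhds)
      rwa [hcl.closure_eq] at this
    · rcases mul_eq_zero.1 (hPmul z) with h | h
      · exact sub_eq_zero.1 h
      · exact absurd h hz
  -- real Wronskian
  have hW : ∀ z, y1 0 z * y2d 0 z - y2 0 z * y1d 0 z = 1 := by
    intro z
    have := HA.wronskian HB z
    simp only [i1, i2, i3, i4] at this
    have h' : ((y1 0 z * y2d 0 z - y2 0 z * y1d 0 z : ℝ) : ℂ) = ((1 : ℝ) : ℂ) := by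
      push_cast; rw [this]; simp
    exact_mod_cast h'
  have hΔ0 : Δ 0 = 2 := by
    have r := rep0 T
    have p1 : fd T = fd 0 := by simpa using hper 0
    have p2 : fdd T = fdd 0 := by simpa using hfddper 0
    simp only [p1, p2] at r
    have r1 : fd 0 = fd 0 * y1 0 T + fdd 0 * y2 0 T := by exact_mod_cast r.1
    have r2 : fdd 0 = fd 0 * y1d 0 T + fdd 0 * y2d 0 T := by exact_mod_cast r.2
    have w := hW T
    rw [hΔ]
    have k1 : fd 0 * (2 - (y1 0 T + y2d 0 T)) = 0 := by
      linear_combination (1 - y2d 0 T) * r1 + y2 0 T * r2 - fd 0 * w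
    have k2 : fdd 0 * (2 - (y1 0 T + y2d 0 T)) = 0 := by
      linear_combination (1 - y1 0 T) * r2 + y1d 0 T * r1 - fdd 0 * w
    by_contra hne
    have hne' : 2 - (y1 0 T + y2d 0 T) ≠ 0 := fun h => hne (by linarith)
    exact hzero 0 ((mul_eq_zero.1 k1).resolve_right hne') ((mul_eq_zero.1 k2).resolve_right hne')
  have b2 : ∀ z, HasDerivAt (y1d 0) (-P z * y1 0 z) z := fun z => (a2 z).congr_deriv (by ring)
  have b4 : ∀ z, HasDerivAt (y2d 0) (-P z * y2 0 z) z := fun z => (a4 z).congr_deriv (by ring)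
  obtain ⟨A, A', hA, hAi, hAd⟩ := hill_complex hPc a1 b2 a3 b4 hW a1 b2
  obtain ⟨B, B', hB, hBi, hBd⟩ := hill_complex hPc a1 b2 a3 b4 hW a3 b4
  have jA : ∀ ν, A ν 0 = 1 ∧ A' ν 0 = 0 := fun ν => by simpa [i1, i2] using hAi ν
  have jB : ∀ ν, B ν 0 = 0 ∧ B' ν 0 = 1 := fun ν => by simpa [i3, i4] using hBi ν
  have hreal : ∀ x : ℝ, (A x T + B' x T : ℂ) = Δ x := by
    intro x
    obtain ⟨c1, c2, c3, c4, d1, d2, d3, d4⟩ := hfund x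
    have r1 := ((Hsol.ofReal c1 c2).rep (hA x) (hB x) (jA x).1 (jA x).2 (jB x).1 (jB x).2 T).1
    have r2 := ((Hsol.ofReal c3 c4).rep (hA x) (hB x) (jA x).1 (jA x).2 (jB x).1 (jB x).2 T).2
    simp only [d1, d2, d3, d4, Complex.ofReal_zero, Complex.ofReal_one, zero_mul, one_mul, add_zero, zero_add] at r1 r2
    rw [hΔ]; push_cast; rw [r1, r2]
  have hDd : Differentiable ℂ (fun ν => A ν T + B' ν T) := (hAd T).1.add (hBd T).2
  obtain ⟨s0, hs0, hcore⟩ := analytic_core _ hDd Δ hreal hΔ0 (|c| * T)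
    (mul_pos (abs_pos.2 hc0) hT) hm hm2 hgap
  refine ⟨(c ^ 2 - 1) * s0, (mul_pos hc1 hs0).ne', fun U hU => ?_⟩
  have hcontm : Continuous (fun s : ℂ => Complex.I * ((c : ℂ) ^ 2 - 1) * s) := by fun_prop
  have hpre : (fun s : ℂ => Complex.I * ((c : ℂ) ^ 2 - 1) * s) ⁻¹' U ∈ nhds (s0 : ℂ) := by
    apply hcontm.continuousAt.preimage_mem_nhds
    convert hU using 2
    push_cast; ring
  obtain ⟨s, hsU, him, ρ, hρ0, hρn, hρD⟩ := hcore _ hpre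
  refine ⟨Complex.I * ((c : ℂ) ^ 2 - 1) * s, ?_, hsU, ?_⟩
  · have hex : ∃ ρ' : ℂ, ρ' ≠ 0 ∧ ‖ρ'‖ = Real.exp (c * T * s.im) ∧
        A (-s ^ 2) T + B' (-s ^ 2) T = ρ' + ρ'⁻¹ := by
      rcases lt_or_gt_of_ne hc0 with h | h
      · refine ⟨ρ⁻¹, inv_ne_zero hρ0, ?_, ?_⟩
        · rw [norm_inv, hρn, abs_of_neg h, ← Real.exp_neg]; congr 1; ring
        · rw [inv_inv]; exact hρD.trans (add_comm _ _)
      · refine ⟨ρ, hρ0, ?_, hρD⟩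
        rw [hρn, abs_of_pos h]
    obtain ⟨ρ', h1, h2, h3⟩ := hex
    obtain ⟨u, v, huv, hne, hq⟩ := floquet hPper (hA _) (hB _) (jA _).1 (jA _).2 (jB _).1 (jB _).2 h1 h3
    exact huv.spec hc hP hne hT hq h2
  · have : (Complex.I * ((c : ℂ) ^ 2 - 1) * s).re = -((c ^ 2 - 1) * s.im) := by
      have : (c : ℂ) ^ 2 - 1 = ((c ^ 2 - 1 : ℝ) : ℂ) := by push_cast; ring
      rw [this, mul_assoc, Complex.I_mul_re, Complex.im_ofReal_mul]
    rw [this]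
    exact neg_ne_zero.2 (mul_ne_zero hc1.ne' him)
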